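/- In the agnostic set-valued online multi-label setting, for any multi-label hypothesis class H with finite LD_S(H) and any T ≥ LD_S(H), there exists a randomized learner A whose set-valued regret satisfies R^set_A(T, H) ≤ LD_S(H) + √(2·LD_S(H)·T·ln(eT/LD_S(H))) = O(√(T·LD_S(H)·log T)). -/

import Mathlib

/-- The prefix of length `t` of a root-to-leaf path `σ`. -/
def pref {Y : Type} {d : ℕ} (σ : Fin d → Y) (t : Fin d) : Fin t.1 → Y :=
  fun i => σ ⟨i.1, i.isLt.trans t.isLt⟩

/-- A complete multi-label tree of depth `d`: at each level `t`, each node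
(reached by a path prefix) carries an instance, and each child (indexed by the
edge label `ŷ`) carries a label in `Y`. -/
structure MTree (X Y : Type) (d : ℕ) where
  inst : ∀ t : Fin d, (Fin t.1 → Y) → X
  lab : ∀ t : Fin d, (Fin t.1 → Y) → Y → Y

/-- Consistency of a hypothesis with the labels along a path. -/
def ConsistentU {X Y : Type} (h : X → Set Y) {d : ℕ} (T : MTree X Y d) (σ : Fin d → Y) : Prop :=
  ∀ t : Fin d, T.lab t (pref σ t) (σ t) ∈ h (T.inst t (pref σ t))

open scoped Classical in
/-- Number of mistakes of path `σ` against hypothesis `h`. -/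
noncomputable def mistakes {X Y : Type} (h : X → Set Y) {d : ℕ} (T : MTree X Y d)
    (σ : Fin d → Y) : ℕ :=
  (Finset.univ.filter (fun t : Fin d => σ t ∉ h (T.inst t (pref σ t)))).card

/-- `T` is `d`-shattered by `(H, μ)` in the mistake-unknown sense. -/
def ShattersU {X Y : Type} (H : Set (X → Set Y)) (μ : (X → Set Y) → ℕ) {d' : ℕ}
    (T : MTree X Y d') (d : ℕ) : Prop :=
  ∀ σ : Fin d' → Y, ∃ h ∈ H, ConsistentU h T σ ∧ d ≤ mistakes h T σ + μ h

/-- Mistake-unknown multi-label Littlestone dimension with offset `μ`. -/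
noncomputable def LDU {X Y : Type} (H : Set (X → Set Y)) (μ : (X → Set Y) → ℕ) : ℕ∞ :=
  ⨆ (d : ℕ) (_ : ∃ d' : ℕ, ∃ T : MTree X Y d', ShattersU H μ T d), (d : ℕ∞)

/-- `T` is shattered by `H` in the mistake-known sense: a mistake at every step. -/
def ShattersK {X Y : Type} (H : Set (X → Set Y)) {d : ℕ} (T : MTree X Y d) : Prop :=
  ∀ σ : Fin d → Y, ∃ h ∈ H, ConsistentU h T σ ∧
    ∀ t : Fin d, σ t ∉ h (T.inst t (pref σ t))

/-- Mistake-known multi-label Littlestone dimension. -/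
noncomputable def LDK {X Y : Type} (H : Set (X → Set Y)) : ℕ∞ :=
  ⨆ (d : ℕ) (_ : ∃ T : MTree X Y d, ShattersK H T), (d : ℕ∞)

/-- A complete set-valued tree of depth `d`. -/
structure STree (X Y : Type) (d : ℕ) where
  inst : ∀ t : Fin d, (Fin t.1 → Y) → X
  lab : ∀ t : Fin d, (Fin t.1 → Y) → Y → Set Y

/-- `T` is shattered by `H` in the set-valued sense. -/
def ShattersS {X Y : Type} (H : Set (X → Set Y)) {d : ℕ} (T : STree X Y d) : Prop :=
  ∀ σ : Fin d → Y, ∃ h ∈ H,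
    (∀ t : Fin d, T.lab t (pref σ t) (σ t) = h (T.inst t (pref σ t))) ∧
    ∀ t : Fin d, σ t ∉ h (T.inst t (pref σ t))

/-- Set-valued Littlestone dimension. -/
noncomputable def LDS {X Y : Type} (H : Set (X → Set Y)) : ℕ∞ :=
  ⨆ (d : ℕ) (_ : ∃ T : STree X Y d, ShattersS H T), (d : ℕ∞)

/-- `RankGE n V` holds when the adversary can force `n` mistakes while keeping some hypothesis
of `V` consistent; it is the recursive form of being shattered at depth `n`. -/
def RankGE {X Y : Type} : ℕ → Set (X → Set Y) → Prop
  | 0, V => V.Nonempty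
  | n + 1, V => ∃ x, ∀ y, ∃ S : Set Y, y ∉ S ∧ RankGE n {h ∈ V | h x = S}

theorem RankGE.exists_shattersS {X Y : Type} {n : ℕ} {V : Set (X → Set Y)} (hV : RankGE n V) :
    ∃ T : STree X Y n, ShattersS V T := by
  induction n generalizing V with
  | zero =>
    obtain ⟨h, hh⟩ := hV
    exact ⟨⟨fun t => t.elim0, fun t => t.elim0⟩, fun σ => ⟨h, hh, fun t => t.elim0, fun t => t.elim0⟩⟩
  | succ n ih =>
    obtain ⟨x, hx⟩ := hV
    choose S hS hR using hx
    choose U hU using fun y => ih (hR y)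
    refine ⟨⟨fun t => Fin.cases (motive := fun t => (Fin t.1 → Y) → X) (fun _ => x)
        (fun k p => (U (p ⟨0, k.succ_pos⟩)).inst k (fun i => p i.succ)) t,
      fun t => Fin.cases (motive := fun t => (Fin t.1 → Y) → Y → Set Y) (fun _ y => S y)
        (fun k p => (U (p ⟨0, k.succ_pos⟩)).lab k (fun i => p i.succ)) t⟩, fun σ => ?_⟩
    obtain ⟨h, ⟨hV, hx⟩, hlab, hmis⟩ := hU (σ 0) (fun i => σ i.succ)
    refine ⟨h, hV, fun t => ?_, fun t => ?_⟩
    · cases t using Fin.cases with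
      | zero => exact hx.symm
      | succ k => exact hlab k
    · cases t using Fin.cases with
      | zero =>
        change σ 0 ∉ h x
        rw [hx]
        exact hS _
      | succ k => exact hmis k

theorem not_rankGE_succ_of_LDS_eq {X Y : Type} {H : Set (X → Set Y)} {d : ℕ}
    (hd : LDS H = (d : ℕ∞)) : ¬ RankGE (d + 1) H := by
  intro hR
  have hle : ((d + 1 : ℕ) : ℕ∞) ≤ LDS H :=
    le_iSup₂_of_le (f := fun (n : ℕ) (_ : ∃ T : STree X Y n, ShattersS H T) => (n : ℕ∞))
      (d + 1) hR.exists_shattersS le_rfl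
  rw [hd, Nat.cast_le] at hle
  omega

/-- The prediction of the standard optimal algorithm on the version space `V` at the instance `x`:
a label such that every mistake brings the rank below `n`. -/
noncomputable def soaPredict {X Y : Type} [Nonempty Y] (n : ℕ) (V : Set (X → Set Y)) (x : X) : Y :=
  Classical.epsilon fun y => ∀ S : Set Y, y ∉ S → ¬ RankGE n {h ∈ V | h x = S}

theorem not_rankGE_of_soaPredict_notMem {X Y : Type} [Nonempty Y] {n : ℕ} {V : Set (X → Set Y)}
    (hV : ¬ RankGE (n + 1) V) (x : X) (S : Set Y) (hS : soaPredict n V x ∉ S) :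
    ¬ RankGE n {h ∈ V | h x = S} := by
  have hex : ∃ y, ∀ S : Set Y, y ∉ S → ¬ RankGE n {h ∈ V | h x = S} := by
    by_contra! hcon
    exact hV ⟨x, hcon⟩
  exact Classical.epsilon_spec hex S hS

/-- The rank bound and version space of the expert that updates exactly at the rounds in `I`.
Histories are listed with the most recent round first. -/
def expertState {X Y : Type} (H : Set (X → Set Y)) (d : ℕ) (I : Finset ℕ) :
    List (X × Set Y) → ℕ × Set (X → Set Y)
  | [] => (d, H)
  | a :: l =>
    if l.length ∈ I then
      ((expertState H d I l).1 - 1, {h ∈ (expertState H d I l).2 | h a.1 = a.2})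
    else expertState H d I l

/-- The prediction of the expert that updates exactly at the rounds in `I`. -/
noncomputable def expertPredict {X Y : Type} [Nonempty Y] (H : Set (X → Set Y)) (d : ℕ)
    (I : Finset ℕ) (l : List (X × Set Y)) (x : X) : Y :=
  soaPredict (expertState H d I l).1 (expertState H d I l).2 x

open scoped Classical in
/-- The loss in one round of the expert that updates exactly at the rounds in `I`. -/
noncomputable def expertLoss {X Y : Type} [Nonempty Y] (H : Set (X → Set Y)) (d : ℕ)
    (I : Finset ℕ) (l : List (X × Set Y)) (a : X × Set Y) : ℝ :=
  if expertPredict H d I l a.1 ∈ a.2 then 0 else 1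

/-- The sum over all rounds of a loss that depends on the earlier rounds, for a history with the
most recent round first. -/
def cumLoss {α : Type*} (F : List α → α → ℝ) : List α → ℝ
  | [] => 0
  | a :: l => cumLoss F l + F l a

theorem sum_ofFn_prefix_eq_cumLoss {α : Type*} (F : List α → α → ℝ) (T : ℕ) (z : Fin T → α) :
    ∑ t : Fin T, F (List.ofFn fun i : Fin t.1 => z ⟨i.1, i.isLt.trans t.isLt⟩).reverse (z t) =
      cumLoss F (List.ofFn z).reverse := by
  induction T with
  | zero => simp [cumLoss]
  | succ T ih =>
    rw [Fin.sum_univ_castSucc, List.ofFn_succ', List.concat_eq_append, List.reverse_append]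
    simp only [List.reverse_singleton, List.singleton_append, cumLoss]
    rw [← ih fun i => z i.castSucc]
    rfl

theorem expertState_congr {X Y : Type} (H : Set (X → Set Y)) (d : ℕ) {I J : Finset ℕ}
    (l : List (X × Set Y)) (hIJ : ∀ i < l.length, i ∈ I ↔ i ∈ J) :
    expertState H d I l = expertState H d J l := by
  induction l with
  | nil => rfl
  | cons a l ih =>
    have hl := ih fun i hi => hIJ i (by simp; omega)
    simp only [expertState, hl, hIJ l.length (by simp)]

theorem cumLoss_expertLoss_congr {X Y : Type} [Nonempty Y] (H : Set (X → Set Y)) (d : ℕ)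
    {I J : Finset ℕ} (l : List (X × Set Y)) (hIJ : ∀ i < l.length, i ∈ I ↔ i ∈ J) :
    cumLoss (expertLoss H d I) l = cumLoss (expertLoss H d J) l := by
  induction l with
  | nil => rfl
  | cons a l ih =>
    have hlt : ∀ i < l.length, i ∈ I ↔ i ∈ J := fun i hi => hIJ i (by simp; omega)
    have hstep : expertLoss H d I l a = expertLoss H d J l a := by
      rw [expertLoss, expertLoss, expertPredict, expertPredict, expertState_congr H d l hlt]
    rw [cumLoss, cumLoss, ih hlt, hstep]

open scoped Classical in
/-- Some expert with at most `d` updates loses at most `d` more than the hypothesis `h`. -/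
theorem exists_expert_cumLoss_le {X Y : Type} [Nonempty Y] {H : Set (X → Set Y)} {d : ℕ}
    (hd : ¬ RankGE (d + 1) H) {h : X → Set Y} (hh : h ∈ H) (l : List (X × Set Y)) :
    ∃ I ⊆ Finset.range l.length, I.card ≤ d ∧ cumLoss (expertLoss H d I) l ≤
      d + cumLoss (fun _ a => if h a.1 ≠ a.2 then (1 : ℝ) else 0) l := by
  suffices hI : ∃ I ⊆ Finset.range l.length, (expertState H d I l).1 + I.card = d ∧
      h ∈ (expertState H d I l).2 ∧
      ¬ RankGE ((expertState H d I l).1 + 1) (expertState H d I l).2 ∧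
      cumLoss (expertLoss H d I) l ≤
        I.card + cumLoss (fun _ a => if h a.1 ≠ a.2 then (1 : ℝ) else 0) l by
    obtain ⟨I, hsub, hcard, -, -, hloss⟩ := hI
    have hle : I.card ≤ d := by omega
    refine ⟨I, hsub, hle, hloss.trans ?_⟩
    gcongr
  induction l with
  | nil => exact ⟨∅, by simp, by simp [expertState], hh, hd, by simp [cumLoss]⟩
  | cons a l ih =>
    obtain ⟨I, hsub, hcard, hmem, hrank, hloss⟩ := ih
    have hnot : l.length ∉ I := fun hmem => by simpa using hsub hmem
    by_cases hupd : h a.1 = a.2 ∧ expertPredict H d I l a.1 ∉ a.2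
    · obtain ⟨heq, hmis⟩ := hupd
      have hagree : ∀ i < l.length, i ∈ insert l.length I ↔ i ∈ I := fun i hi => by
        simp [hi.ne]
      have hstate := expertState_congr H d l hagree
      have hrank' := not_rankGE_of_soaPredict_notMem hrank a.1 a.2 hmis
      have hmem' : h ∈ {g ∈ (expertState H d I l).2 | g a.1 = a.2} := ⟨hmem, heq⟩
      have hpos : (expertState H d I l).1 ≠ 0 := fun h0 => by
        rw [h0] at hrank'
        exact hrank' ⟨h, hmem'⟩
      have hnew : expertState H d (insert l.length I) (a :: l) =
          ((expertState H d I l).1 - 1, {g ∈ (expertState H d I l).2 | g a.1 = a.2}) := by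
        simp only [expertState, hstate, Finset.mem_insert_self, if_true]
      refine ⟨insert l.length I, ?_, ?_, ?_, ?_, ?_⟩
      · intro i hi
        rcases Finset.mem_insert.1 hi with rfl | hi
        · simp
        · have := Finset.mem_range.1 (hsub hi)
          simp only [List.length_cons, Finset.mem_range]
          omega
      · rw [hnew, Finset.card_insert_of_notMem hnot]
        dsimp only
        omega
      · rw [hnew]
        exact hmem'
      · rw [hnew]
        dsimp only
        rwa [Nat.sub_add_cancel (Nat.one_le_iff_ne_zero.2 hpos)]
      · have hone : expertLoss H d (insert l.length I) l a ≤ 1 := by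
          unfold expertLoss
          split_ifs <;> norm_num
        rw [Finset.card_insert_of_notMem hnot]
        simp only [cumLoss, cumLoss_expertLoss_congr H d l hagree, heq, ne_eq, not_true,
          if_false]
        push_cast
        linarith
    · have hnew : expertState H d I (a :: l) = expertState H d I l := by
        simp only [expertState, hnot, if_false]
      refine ⟨I, hsub.trans (Finset.range_subset_range.2 (by simp)), by rw [hnew]; exact hcard,
        by rw [hnew]; exact hmem, by rw [hnew]; exact hrank, ?_⟩
      have hle : expertLoss H d I l a ≤ if h a.1 ≠ a.2 then (1 : ℝ) else 0 := by
        unfold expertLoss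
        split_ifs <;> first | tauto | norm_num
      simp only [cumLoss]
      linarith

theorem Real.exp_neg_le_one_sub_add_sq_div_two {x : ℝ} (hx : 0 ≤ x) :
    Real.exp (-x) ≤ 1 - x + x ^ 2 / 2 := by
  have hquad := Real.quadratic_le_exp_of_nonneg hx
  have hpos : 0 < 1 - x + x ^ 2 / 2 := by nlinarith [sq_nonneg (x - 1)]
  rw [Real.exp_neg, inv_le_comm₀ (Real.exp_pos x) hpos]
  refine le_trans ?_ hquad
  rw [inv_le_iff_one_le_mul₀ hpos]
  nlinarith [sq_nonneg (x ^ 2)]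

/-- The exponential weight of the expert `i`. -/
noncomputable def hedgeWeight {α ι : Type*} (F : ι → List α → α → ℝ) (η : ℝ) (l : List α)
    (i : ι) : ℝ :=
  Real.exp (-(η * cumLoss (F i) l))

/-- The probability with which the exponentially weighted forecaster follows the expert `i`. -/
noncomputable def hedgeProb {α ι : Type*} [Fintype ι] (F : ι → List α → α → ℝ) (η : ℝ)
    (l : List α) (i : ι) : ℝ :=
  hedgeWeight F η l i / ∑ j, hedgeWeight F η l j

section Hedge

variable {α ι : Type*} [Fintype ι] (F : ι → List α → α → ℝ) (η : ℝ)

theorem hedgeProb_nonneg (l : List α) (i : ι) : 0 ≤ hedgeProb F η l i :=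
  div_nonneg (Real.exp_nonneg _) (Finset.sum_nonneg fun _ _ => Real.exp_nonneg _)

theorem sum_hedgeWeight_pos [Nonempty ι] (l : List α) : 0 < ∑ i, hedgeWeight F η l i :=
  Finset.sum_pos (fun _ _ => Real.exp_pos _) Finset.univ_nonempty

theorem sum_hedgeProb [Nonempty ι] (l : List α) : ∑ i, hedgeProb F η l i = 1 := by
  simp only [hedgeProb]
  rw [← Finset.sum_div, div_self (sum_hedgeWeight_pos F η l).ne']

variable {F η}

theorem sum_hedgeWeight_le [Nonempty ι] (hη : 0 ≤ η) (h0 : ∀ i l a, 0 ≤ F i l a)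
    (h1 : ∀ i l a, F i l a ≤ 1) (l : List α) :
    ∑ i, hedgeWeight F η l i ≤ Fintype.card ι *
      Real.exp (-(η * cumLoss (fun l a => ∑ i, hedgeProb F η l i * F i l a) l) +
        l.length * (η ^ 2 / 2)) := by
  induction l with
  | nil => simp [hedgeWeight, cumLoss]
  | cons a l ih =>
    set W := ∑ i, hedgeWeight F η l i with hW
    set g := ∑ i, hedgeProb F η l i * F i l a with hg
    have hWpos : 0 < W := sum_hedgeWeight_pos F η l
    have hWg : ∑ i, hedgeWeight F η l i * F i l a = W * g := by
      rw [hg, Finset.mul_sum]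
      refine Finset.sum_congr rfl fun i _ => ?_
      simp only [hedgeProb, ← hW]
      field_simp
    have hstep : ∑ i, hedgeWeight F η (a :: l) i ≤ W * (1 - η * g + η ^ 2 / 2) := by
      calc ∑ i, hedgeWeight F η (a :: l) i
          = ∑ i, hedgeWeight F η l i * Real.exp (-(η * F i l a)) := by
            refine Finset.sum_congr rfl fun i _ => ?_
            rw [hedgeWeight, hedgeWeight, ← Real.exp_add, cumLoss]
            ring_nf
        _ ≤ ∑ i, hedgeWeight F η l i * (1 - η * F i l a + η ^ 2 / 2) := by
            refine Finset.sum_le_sum fun i _ =>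
              mul_le_mul_of_nonneg_left ?_ (Real.exp_nonneg _)
            refine (Real.exp_neg_le_one_sub_add_sq_div_two (mul_nonneg hη (h0 i l a))).trans ?_
            have hsq : F i l a ^ 2 ≤ 1 := pow_le_one₀ (h0 i l a) (h1 i l a)
            nlinarith [mul_le_mul_of_nonneg_left hsq (sq_nonneg η)]
        _ = ∑ i, hedgeWeight F η l i * (1 + η ^ 2 / 2)
              - η * ∑ i, hedgeWeight F η l i * F i l a := by
            rw [Finset.mul_sum, ← Finset.sum_sub_distrib]
            exact Finset.sum_congr rfl fun i _ => by ring
        _ = W * (1 - η * g + η ^ 2 / 2) := by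
            rw [hWg, ← Finset.sum_mul, ← hW]
            ring
    have hexp : 1 - η * g + η ^ 2 / 2 ≤ Real.exp (-(η * g) + η ^ 2 / 2) := by
      linarith [Real.add_one_le_exp (-(η * g) + η ^ 2 / 2)]
    refine hstep.trans ((mul_le_mul_of_nonneg_left hexp hWpos.le).trans
      ((mul_le_mul_of_nonneg_right ih (Real.exp_nonneg _)).trans_eq ?_))
    rw [mul_assoc, ← Real.exp_add]
    simp only [cumLoss, List.length_cons, ← hg]
    push_cast
    ring_nf

/-- The regret bound of the exponentially weighted forecaster. -/
theorem cumLoss_hedge_le [Nonempty ι] (hη : 0 < η) (h0 : ∀ i l a, 0 ≤ F i l a)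
    (h1 : ∀ i l a, F i l a ≤ 1) (l : List α) (i : ι) :
    cumLoss (fun l a => ∑ i, hedgeProb F η l i * F i l a) l ≤
      cumLoss (F i) l + Real.log (Fintype.card ι) / η + l.length * η / 2 := by
  have hle : hedgeWeight F η l i ≤ _ :=
    (Finset.single_le_sum (f := hedgeWeight F η l) (fun _ _ => Real.exp_nonneg _)
      (Finset.mem_univ i)).trans
      (sum_hedgeWeight_le hη.le h0 h1 l)
  have hcard : (0 : ℝ) < Fintype.card ι := by exact_mod_cast Fintype.card_pos
  have hlog := Real.log_le_log (Real.exp_pos _) hle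
  rw [Real.log_exp, Real.log_mul hcard.ne' (Real.exp_pos _).ne', Real.log_exp] at hlog
  refine le_of_mul_le_mul_left ?_ hη
  have hexpand : η * (cumLoss (F i) l + Real.log (Fintype.card ι) / η + l.length * η / 2) =
      η * cumLoss (F i) l + Real.log (Fintype.card ι) + l.length * (η ^ 2 / 2) := by
    field_simp
  rw [hexpand]
  linarith

end Hedge

/-- The update schedules with at most `d` updates in `T` rounds. -/
def schedules (d T : ℕ) : Finset (Finset ℕ) :=
  (Finset.range T).powerset.filter fun I => I.card ≤ d

theorem card_schedules_le {d T : ℕ} (hd : 0 < d) (hT : d ≤ T) :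
    ((schedules d T).card : ℝ) ≤ (Real.exp 1 * T / d) ^ d := by
  have hd' : (0 : ℝ) < d := by exact_mod_cast hd
  have hT' : (0 : ℝ) < T := by exact_mod_cast hd.trans_le hT
  have hq0 : (0 : ℝ) < d / T := by positivity
  have hq1 : (d / T : ℝ) ≤ 1 := by
    rw [div_le_one hT']
    exact_mod_cast hT
  have hsum : ((schedules d T).card : ℝ) * (d / T : ℝ) ^ d ≤ Real.exp 1 ^ d := by
    calc ((schedules d T).card : ℝ) * (d / T : ℝ) ^ d
        = ∑ I ∈ schedules d T, (d / T : ℝ) ^ d := by simp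
      _ ≤ ∑ I ∈ schedules d T, (d / T : ℝ) ^ I.card :=
          Finset.sum_le_sum fun I hI =>
            pow_le_pow_of_le_one hq0.le hq1 (Finset.mem_filter.1 hI).2
      _ ≤ ∑ I ∈ (Finset.range T).powerset, (d / T : ℝ) ^ I.card :=
          Finset.sum_le_sum_of_subset_of_nonneg (Finset.filter_subset _ _)
            fun _ _ _ => by positivity
      _ = (d / T + 1 : ℝ) ^ T := by
          simpa using Finset.sum_pow_mul_eq_add_pow (d / T : ℝ) 1 (Finset.range T)
      _ ≤ Real.exp (d / T) ^ T := by
          gcongr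
          exact Real.add_one_le_exp _
      _ = Real.exp 1 ^ d := by
          rw [← Real.exp_nat_mul, ← Real.exp_nat_mul]
          congr 1
          field_simp
  rw [← le_div_iff₀ (by positivity)] at hsum
  refine hsum.trans_eq ?_
  rw [← div_pow]
  congr 1
  field_simp

/-- The randomized learner that follows the prediction of an expert drawn with the exponential
weights. -/
noncomputable def hedgePMF {α ι β : Type*} [Fintype ι] [Nonempty ι] (F : ι → List α → α → ℝ)
    (η : ℝ) (l : List α) (E : ι → β) : PMF β :=
  (PMF.ofFintype (fun i => ENNReal.ofReal (hedgeProb F η l i)) (by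
    rw [← ENNReal.ofReal_sum_of_nonneg fun i _ => hedgeProb_nonneg F η l i, sum_hedgeProb,
      ENNReal.ofReal_one])).map E

open scoped Classical in
theorem toReal_toOuterMeasure_hedgePMF {α ι β : Type*} [Fintype ι] [Nonempty ι]
    (F : ι → List α → α → ℝ) (η : ℝ) (l : List α) (E : ι → β) (S : Set β) :
    ((hedgePMF F η l E).toOuterMeasure {y | y ∉ S}).toReal =
      ∑ i, hedgeProb F η l i * if E i ∈ S then 0 else 1 := by
  rw [hedgePMF, PMF.toOuterMeasure_map_apply, PMF.toOuterMeasure_apply_fintype,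
    ENNReal.toReal_sum]
  · refine Finset.sum_congr rfl fun i _ => ?_
    by_cases hi : E i ∈ S <;> simp [Set.indicator, hi, hedgeProb_nonneg]
  · intro i _
    by_cases hi : E i ∈ S <;> simp [Set.indicator, hi]

theorem expertLoss_nonneg {X Y : Type} [Nonempty Y] (H : Set (X → Set Y)) (d : ℕ)
    (I : Finset ℕ) (l : List (X × Set Y)) (a : X × Set Y) : 0 ≤ expertLoss H d I l a := by
  unfold expertLoss
  split_ifs <;> norm_num

theorem expertLoss_le_one {X Y : Type} [Nonempty Y] (H : Set (X → Set Y)) (d : ℕ)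
    (I : Finset ℕ) (l : List (X × Set Y)) (a : X × Set Y) : expertLoss H d I l a ≤ 1 := by
  unfold expertLoss
  split_ifs <;> norm_num

open scoped Classical in
theorem exists_learner_cumLoss_le {X Y : Type} [Nonempty Y] {H : Set (X → Set Y)} {d T : ℕ}
    (hd : ¬ RankGE (d + 1) H) (hT : d ≤ T) :
    ∃ B : List (X × Set Y) → X → PMF Y, ∀ l : List (X × Set Y), l.length = T → ∀ h ∈ H,
      cumLoss (fun l a => ((B l a.1).toOuterMeasure {y | y ∉ a.2}).toReal) l ≤
        d + Real.sqrt (2 * d * T * Real.log (Real.exp 1 * T / d)) +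
          cumLoss (fun _ a => if h a.1 ≠ a.2 then (1 : ℝ) else 0) l := by
  rcases Nat.eq_zero_or_pos d with rfl | hpos
  · refine ⟨fun l x => PMF.pure (expertPredict H 0 ∅ l x), fun l _ h hh => ?_⟩
    obtain ⟨I, -, hcard, hloss⟩ := exists_expert_cumLoss_le hd hh l
    obtain rfl : I = ∅ := Finset.card_eq_zero.1 (Nat.le_zero.1 hcard)
    have hF : (fun (l : List (X × Set Y)) (a : X × Set Y) =>
        ((PMF.pure (expertPredict H 0 ∅ l a.1)).toOuterMeasure {y | y ∉ a.2}).toReal) =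
        expertLoss H 0 ∅ := by
      funext l a
      rw [PMF.toOuterMeasure_pure_apply, expertLoss]
      by_cases ha : expertPredict H 0 ∅ l a.1 ∈ a.2 <;> simp [ha]
    rw [hF]
    simpa using hloss
  · have hd' : (0 : ℝ) < d := by exact_mod_cast hpos
    have hT' : (0 : ℝ) < T := by exact_mod_cast hpos.trans_le hT
    have hne : Nonempty (schedules d T) := ⟨∅, by simp [schedules]⟩
    set M : ℝ := d * Real.log (Real.exp 1 * T / d) with hM
    have hMpos : 0 < M := by
      refine mul_pos hd' (Real.log_pos ?_)
      rw [lt_div_iff₀ hd', one_mul]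
      have : (d : ℝ) ≤ T := by exact_mod_cast hT
      nlinarith [Real.add_one_lt_exp one_ne_zero]
    have hlogN : Real.log (Fintype.card (schedules d T)) ≤ M := by
      rw [hM, ← Real.log_pow]
      refine Real.log_le_log (by exact_mod_cast Fintype.card_pos) ?_
      rw [Fintype.card_coe]
      exact card_schedules_le hpos hT
    set s : ℝ := Real.sqrt (2 * d * T * Real.log (Real.exp 1 * T / d)) with hs
    have hsq : s ^ 2 = 2 * T * M := by
      have harg : 2 * d * T * Real.log (Real.exp 1 * T / d) = 2 * T * M := by
        rw [hM]
        ring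
      rw [hs, harg, Real.sq_sqrt (by positivity)]
    have hspos : 0 < s := by
      refine lt_of_le_of_ne (Real.sqrt_nonneg _) fun h0 => ?_
      rw [← h0] at hsq
      have : 0 < 2 * T * M := by positivity
      simp [← hsq] at this
    let F : schedules d T → List (X × Set Y) → X × Set Y → ℝ := fun I => expertLoss H d I
    refine ⟨fun l x => hedgePMF F (s / T) l fun I => expertPredict H d I l x,
      fun l hl h hh => ?_⟩
    obtain ⟨I, hsub, hcard, hloss⟩ := exists_expert_cumLoss_le hd hh l
    have hI : I ∈ schedules d T :=
      Finset.mem_filter.2 ⟨Finset.mem_powerset.2 (hl ▸ hsub), hcard⟩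
    have hregret := cumLoss_hedge_le (F := F) (div_pos hspos hT')
      (fun _ _ _ => expertLoss_nonneg ..) (fun _ _ _ => expertLoss_le_one ..) l ⟨I, hI⟩
    have htune : Real.log (Fintype.card (schedules d T)) / (s / T) + l.length * (s / T) / 2 ≤
        s := by
      have hdiv : Real.log (Fintype.card (schedules d T)) / (s / T) ≤ M / (s / T) := by
        gcongr
      have hfst : M / (s / T) = s / 2 := by
        field_simp
        linarith
      have hsnd : (l.length : ℝ) * (s / T) / 2 = s / 2 := by
        rw [hl]
        field_simp
      linarith
    simp only [toReal_toOuterMeasure_hedgePMF]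
    change cumLoss (fun l a => ∑ i, hedgeProb F (s / T) l i * F i l a) l ≤ _
    have hFI : cumLoss (F ⟨I, hI⟩) l = cumLoss (expertLoss H d I) l := rfl
    linarith

theorem nonempty_label_of_LDS_eq {X Y : Type} [Nonempty X] {H : Set (X → Set Y)} {d : ℕ}
    (hd : LDS H = (d : ℕ∞)) : Nonempty Y := by
  by_contra hY
  rw [not_nonempty_iff] at hY
  exact not_rankGE_succ_of_LDS_eq hd ⟨Classical.arbitrary X, fun y => isEmptyElim y⟩

open scoped Classical in
/-- Agnostic set-valued online learning: there is a randomized learner whose set-valued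
regret is at most LDS(H) + √(2·LDS(H)·T·ln(eT/LDS(H))). -/
theorem stmt16 {X Y : Type} [Fintype Y] (H : Set (X → Set Y)) (hne : H.Nonempty)
    (d T : ℕ) (hd : LDS H = (d : ℕ∞)) (hT : d ≤ T) :
    ∃ A : List (X × Set Y) → X → PMF Y,
      ∀ (x : Fin T → X) (S : Fin T → Set Y),
        (∑ t : Fin T,
            ((A (List.ofFn fun i : Fin t.1 =>
                  (x ⟨i.1, i.isLt.trans t.isLt⟩, S ⟨i.1, i.isLt.trans t.isLt⟩)) (x t)).toOuterMeasure
              {y | y ∉ S t}).toReal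
          - ⨅ h : H, ∑ t : Fin T, (if (h : X → Set Y) (x t) ≠ S t then (1 : ℝ) else 0))
        ≤ (d : ℝ) + Real.sqrt (2 * d * T * Real.log (Real.exp 1 * T / d)) := by
  rcases isEmpty_or_nonempty X with hX | hX
  · refine ⟨fun _ x => isEmptyElim x, fun x S => ?_⟩
    have hT0 : T = 0 := by
      by_contra h0
      exact isEmptyElim (x ⟨0, Nat.pos_of_ne_zero h0⟩)
    subst hT0
    have : Nonempty H := hne.to_subtype
    simp
  · have hY := nonempty_label_of_LDS_eq hd
    obtain ⟨B, hB⟩ := exists_learner_cumLoss_le (not_rankGE_succ_of_LDS_eq hd) hT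
    refine ⟨fun l => B l.reverse, fun x S => ?_⟩
    have : Nonempty H := hne.to_subtype
    rw [sub_le_comm]
    refine le_ciInf fun h => ?_
    have hregret := hB (List.ofFn fun t => (x t, S t)).reverse (by simp) h h.2
    rw [← sum_ofFn_prefix_eq_cumLoss, ← sum_ofFn_prefix_eq_cumLoss] at hregret
    dsimp only at hregret ⊢
    linarith
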